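/- Let g be an element of a right-angled Artin group A(Γ) that is cyclically syllable-reduced and is not a star word. Then for every integer m, the syllable length of g^m equals |m| times the syllable length of g. -/

import Mathlib

/-- The commutation relations defining the right-angled Artin group of a graph `Γ`. -/
def raagRels {V : Type*} (Γ : SimpleGraph V) : Set (FreeGroup V) :=
  {w | ∃ u v : V, Γ.Adj u v ∧
    w = FreeGroup.of u * FreeGroup.of v * (FreeGroup.of u)⁻¹ * (FreeGroup.of v)⁻¹}

/-- The right-angled Artin group `A(Γ)` of a graph `Γ`. -/
abbrev Raag {V : Type*} (Γ : SimpleGraph V) := PresentedGroup (raagRels Γ)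

/-- The generator of `A(Γ)` corresponding to a vertex `v`. -/
def raagGen {V : Type*} (Γ : SimpleGraph V) (v : V) : Raag Γ := PresentedGroup.of v

/-- A syllable: a nonzero power of a vertex generator. -/
def IsSyllable {V : Type*} (Γ : SimpleGraph V) (s : Raag Γ) : Prop :=
  ∃ (v : V) (k : ℤ), k ≠ 0 ∧ s = (raagGen Γ v) ^ k

/-- The syllable length of `g`: the minimal number of syllables whose product is `g`. -/
noncomputable def sylLength {V : Type*} (Γ : SimpleGraph V) (g : Raag Γ) : ℕ :=
  sInf {n | ∃ l : List (Raag Γ), l.length = n ∧ (∀ x ∈ l, IsSyllable Γ x) ∧ l.prod = g}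

/-- The closed star of a vertex `v` in `Γ`: `v` together with its neighbors. -/
def starSet {V : Type*} (Γ : SimpleGraph V) (v : V) : Set V := {u | u = v ∨ Γ.Adj u v}

/-- An element of `A(Γ)` is a star word if its support lies in the closed star of some vertex,
equivalently it lies in the subgroup generated by the star of some vertex. -/
def IsStarElt {V : Type*} (Γ : SimpleGraph V) (g : Raag Γ) : Prop :=
  ∃ v : V, g ∈ Subgroup.closure (raagGen Γ '' starSet Γ v)

/-! ### A lower bound for the syllable length, from a representation of `A(Γ)` -/

section Rep

open Classical

variable {V : Type*} (Γ : SimpleGraph V)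

/-- `i` can be added to the set `S` of positions. -/
def RAdd (lab : ℕ → V) (S : Finset ℕ) (i : ℕ) : Prop :=
  i ∉ S ∧ (∀ k, k < i → ¬ Γ.Adj (lab k) (lab i) → k ∈ S) ∧
    (∀ k, i < k → ¬ Γ.Adj (lab k) (lab i) → k ∉ S)

/-- The square-zero operator attached to a vertex. -/
noncomputable def XOp (lab : ℕ → V) (N : ℕ) (v : V) : Module.End ℤ (Finset ℕ → ℤ) where
  toFun f S := ∑ i ∈ Finset.range N, if lab i = v ∧ RAdd Γ lab S i then f (insert i S) else 0
  map_add' f g := by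
    funext S
    simp only [Pi.add_apply]
    rw [← Finset.sum_add_distrib]
    refine Finset.sum_congr rfl fun i _ => ?_
    split_ifs <;> simp
  map_smul' c f := by
    funext S
    simp only [Pi.smul_apply, RingHom.id_apply, smul_eq_mul]
    rw [Finset.mul_sum]
    refine Finset.sum_congr rfl fun i _ => ?_
    split_ifs <;> simp

theorem XOp_apply (lab : ℕ → V) (N : ℕ) (v : V) (f : Finset ℕ → ℤ) (S : Finset ℕ) :
    XOp Γ lab N v f S =
      ∑ i ∈ Finset.range N, if lab i = v ∧ RAdd Γ lab S i then f (insert i S) else 0 := rfl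

theorem XOp_mul_apply (lab : ℕ → V) (N : ℕ) (u v : V) (f : Finset ℕ → ℤ) (S : Finset ℕ) :
    (XOp Γ lab N u * XOp Γ lab N v) f S =
      ∑ i ∈ Finset.range N, ∑ j ∈ Finset.range N,
        if (lab i = u ∧ RAdd Γ lab S i) ∧ (lab j = v ∧ RAdd Γ lab (insert i S) j)
        then f (insert j (insert i S)) else 0 := by
  rw [Module.End.mul_apply, XOp_apply]
  refine Finset.sum_congr rfl fun i _ => ?_
  by_cases h : lab i = u ∧ RAdd Γ lab S i
  · rw [if_pos h, XOp_apply]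
    refine Finset.sum_congr rfl fun j _ => ?_
    simp only [h, true_and, and_self]
  · rw [if_neg h]
    simp only [h, false_and, if_false, Finset.sum_const_zero]

theorem RAdd_swap (lab : ℕ → V) {i j : ℕ} (hij : Γ.Adj (lab i) (lab j)) {S : Finset ℕ}
    (h1 : RAdd Γ lab S i) (h2 : RAdd Γ lab (insert i S) j) :
    RAdd Γ lab S j ∧ RAdd Γ lab (insert j S) i := by
  have hne : i ≠ j := by
    rintro rfl
    exact Γ.loopless.irrefl _ hij
  have hji := hij.symm
  obtain ⟨a1, a2, a3⟩ := h1
  obtain ⟨b1, b2, b3⟩ := h2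
  simp only [Finset.mem_insert, not_or] at b1 b2 b3
  refine ⟨⟨b1.2, fun k hk hn => ?_, fun k hk hn => (b3 k hk hn).2⟩, ?_, fun k hk hn => ?_,
    fun k hk hn => ?_⟩
  · rcases b2 k hk hn with rfl | h
    · exact absurd hij hn
    · exact h
  · simp only [Finset.mem_insert, not_or]
    exact ⟨hne, a1⟩
  · exact Finset.mem_insert_of_mem (a2 k hk hn)
  · simp only [Finset.mem_insert, not_or]
    refine ⟨?_, a3 k hk hn⟩
    rintro rfl
    exact hn hji

theorem XOp_comm (lab : ℕ → V) (N : ℕ) {u v : V} (huv : Γ.Adj u v) :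
    XOp Γ lab N u * XOp Γ lab N v = XOp Γ lab N v * XOp Γ lab N u := by
  refine LinearMap.ext fun f => funext fun S => ?_
  rw [XOp_mul_apply, XOp_mul_apply, Finset.sum_comm]
  refine Finset.sum_congr rfl fun j _ => Finset.sum_congr rfl fun i _ => ?_
  rw [Finset.insert_comm]
  refine if_congr ?_ rfl rfl
  constructor
  · rintro ⟨⟨rfl, h1⟩, rfl, h2⟩
    have := RAdd_swap Γ lab huv h1 h2
    exact ⟨⟨rfl, this.1⟩, rfl, this.2⟩
  · rintro ⟨⟨rfl, h1⟩, rfl, h2⟩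
    have := RAdd_swap Γ lab huv.symm h1 h2
    exact ⟨⟨rfl, this.1⟩, rfl, this.2⟩

/-- A reduced sequence of labels. -/
def RedSeq (lab : ℕ → V) (N : ℕ) : Prop :=
  ∀ i j, i < j → j < N → lab i = lab j → ∃ k, i < k ∧ k < j ∧ ¬ Γ.Adj (lab k) (lab i)

theorem XOp_sq {lab : ℕ → V} {N : ℕ} (hred : RedSeq Γ lab N) (v : V) :
    XOp Γ lab N v * XOp Γ lab N v = 0 := by
  refine LinearMap.ext fun f => funext fun S => ?_
  rw [XOp_mul_apply]
  refine Finset.sum_eq_zero fun i _ => Finset.sum_eq_zero fun j hj => if_neg ?_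
  rintro ⟨⟨rfl, a1, a2, a3⟩, hl, b1, b2, b3⟩
  simp only [Finset.mem_insert, not_or] at b1 b2 b3
  rcases lt_trichotomy i j with h | h | h
  · obtain ⟨k, k1, k2, k3⟩ := hred i j h (Finset.mem_range.1 hj) hl.symm
    rcases b2 k k2 (by rwa [hl]) with h' | h'
    · omega
    · exact a3 k k1 k3 h'
  · exact b1.1 h.symm
  · exact b1.2 (a2 j h (by rw [hl]; exact Γ.loopless.irrefl _))

/-- The unit `1 + X_v`. -/
noncomputable def UOp {lab : ℕ → V} {N : ℕ} (hred : RedSeq Γ lab N) (v : V) :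
    (Module.End ℤ (Finset ℕ → ℤ))ˣ where
  val := 1 + XOp Γ lab N v
  inv := 1 - XOp Γ lab N v
  val_inv := by
    have := XOp_sq Γ hred v
    simp only [mul_sub, add_mul, mul_one, one_mul, this]
    abel
  inv_val := by
    have := XOp_sq Γ hred v
    simp only [mul_add, sub_mul, mul_one, one_mul, this]
    abel

theorem UOp_comm {lab : ℕ → V} {N : ℕ} (hred : RedSeq Γ lab N) {u v : V} (h : Γ.Adj u v) :
    UOp Γ hred u * UOp Γ hred v = UOp Γ hred v * UOp Γ hred u := by
  apply Units.ext
  change (1 + XOp Γ lab N u) * (1 + XOp Γ lab N v) = (1 + XOp Γ lab N v) * (1 + XOp Γ lab N u)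
  have := XOp_comm Γ lab N h
  simp only [mul_add, add_mul, mul_one, one_mul, this]
  abel

/-- The representation. -/
noncomputable def rep {lab : ℕ → V} {N : ℕ} (hred : RedSeq Γ lab N) :
    Raag Γ →* (Module.End ℤ (Finset ℕ → ℤ))ˣ :=
  PresentedGroup.toGroup (f := UOp Γ hred) (by
    rintro r ⟨u, v, h, rfl⟩
    simp only [map_mul, map_inv, FreeGroup.lift_apply_of]
    rw [UOp_comm Γ hred h]
    group)

theorem rep_gen {lab : ℕ → V} {N : ℕ} (hred : RedSeq Γ lab N) (v : V) :
    rep Γ hred (raagGen Γ v) = UOp Γ hred v := PresentedGroup.toGroup.of _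

theorem rep_gen_zpow {lab : ℕ → V} {N : ℕ} (hred : RedSeq Γ lab N) (v : V) (k : ℤ) :
    ((rep Γ hred (raagGen Γ v ^ k) : (Module.End ℤ (Finset ℕ → ℤ))ˣ) :
      Module.End ℤ (Finset ℕ → ℤ)) = 1 + k • XOp Γ lab N v := by
  rw [map_zpow, rep_gen]
  have hsq := XOp_sq Γ hred v
  induction k using Int.induction_on with
  | zero => simp
  | succ n ih =>
    rw [zpow_add, zpow_one, Units.val_mul, ih]
    change (1 + (n : ℤ) • XOp Γ lab N v) * (1 + XOp Γ lab N v) = _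
    simp only [mul_add, add_mul, smul_mul_assoc, hsq, add_smul, mul_one, one_mul, smul_zero,
      one_smul, add_zero]
    abel
  | pred n ih =>
    rw [zpow_sub, zpow_one, Units.val_mul, ih]
    change (1 + (-n : ℤ) • XOp Γ lab N v) * (1 - XOp Γ lab N v) = _
    simp only [mul_sub, add_mul, smul_mul_assoc, hsq, sub_smul, mul_one, one_mul, smul_zero,
      one_smul, add_zero]
    abel

theorem rep_gen_zpow_apply {lab : ℕ → V} {N : ℕ} (hred : RedSeq Γ lab N) (v : V) (k : ℤ)
    (f : Finset ℕ → ℤ) (S : Finset ℕ) :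
    (rep Γ hred (raagGen Γ v ^ k)).val f S = f S + k * XOp Γ lab N v f S := by
  rw [rep_gen_zpow]
  rfl

theorem rep_vanish {lab : ℕ → V} {N : ℕ} (hred : RedSeq Γ lab N) (f : Finset ℕ → ℤ) (c : ℕ)
    (hf : ∀ S : Finset ℕ, S.card < c → f S = 0) (l : List (Raag Γ))
    (hl : ∀ x ∈ l, IsSyllable Γ x) :
    ∀ S : Finset ℕ, S.card + l.length < c → (rep Γ hred l.prod).val f S = 0 := by
  induction l with
  | nil =>
    intro S hS
    simpa using hf S (by simpa using hS)
  | cons x l ih =>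
    intro S hS
    obtain ⟨v, k, -, rfl⟩ := hl x (by simp)
    have ih' := ih (fun y hy => hl y (by simp [hy]))
    rw [List.length_cons] at hS
    rw [List.prod_cons, map_mul, Units.val_mul, Module.End.mul_apply, rep_gen_zpow_apply,
      ih' S (by omega), XOp_apply, Finset.sum_eq_zero, mul_zero, add_zero]
    intro i _
    split_ifs
    · apply ih'
      have := Finset.card_insert_le i S
      omega
    · rfl

/-- Partial products of a sequence of syllables. -/
def PW (lab : ℕ → V) (e : ℕ → ℤ) (a b : ℕ) : Raag Γ :=
  ((List.range b).map fun i => raagGen Γ (lab (a + i)) ^ e (a + i)).prod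

theorem PW_add (lab : ℕ → V) (e : ℕ → ℤ) (a b c : ℕ) :
    PW Γ lab e a (b + c) = PW Γ lab e a b * PW Γ lab e (a + b) c := by
  simp only [PW, List.range_add, List.map_append, List.prod_append, List.map_map]
  congr 3
  funext i
  simp [add_assoc]

theorem PW_one (lab : ℕ → V) (e : ℕ → ℤ) (a : ℕ) :
    PW Γ lab e a 1 = raagGen Γ (lab a) ^ e a := by
  simp [PW]

theorem PW_zero (lab : ℕ → V) (e : ℕ → ℤ) (a : ℕ) : PW Γ lab e a 0 = 1 := by
  simp [PW]

theorem PW_word {lab : ℕ → V} {e : ℕ → ℤ} (he : ∀ i, e i ≠ 0) (a b : ℕ) :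
    ∃ l : List (Raag Γ), l.length = b ∧ (∀ x ∈ l, IsSyllable Γ x) ∧ l.prod = PW Γ lab e a b := by
  refine ⟨_, ?_, ?_, rfl⟩
  · simp
  · intro x hx
    obtain ⟨i, -, rfl⟩ := List.mem_map.1 hx
    exact ⟨_, _, he _, rfl⟩

theorem rep_PW {lab : ℕ → V} {N : ℕ} (hred : RedSeq Γ lab N) {e : ℕ → ℤ} (he : ∀ i, e i ≠ 0)
    (b : ℕ) : ∀ a, a + b = N → (rep Γ hred (PW Γ lab e a b)).val
      (fun S => if S = Finset.range N then 1 else 0) (Finset.range a) ≠ 0 := by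
  induction b with
  | zero =>
    intro a ha
    have : a = N := by omega
    subst this
    simp [PW_zero]
  | succ b ih =>
    intro a ha
    have hz : (rep Γ hred (PW Γ lab e (a + 1) b)).val
      (fun S => if S = Finset.range N then 1 else 0) (Finset.range a) = 0 := by
      obtain ⟨l, hl1, hl2, hl3⟩ := PW_word Γ (lab := lab) he (a + 1) b
      rw [← hl3]
      apply rep_vanish Γ hred _ N _ l hl2
      · rw [hl1, Finset.card_range]
        omega
      · intro S hS
        apply if_neg
        rintro rfl
        simp at hS
    rw [add_comm b 1, PW_add, PW_one, map_mul, Units.val_mul, Module.End.mul_apply,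
      rep_gen_zpow_apply, hz, zero_add, XOp_apply]
    refine mul_ne_zero (he a) ?_
    rw [Finset.sum_eq_single a]
    · rw [if_pos, ← Finset.range_add_one]
      · exact ih (a + 1) (by omega)
      · refine ⟨rfl, by simp, fun k hk _ => by simpa using hk, fun k hk _ => ?_⟩
        simp only [Finset.mem_range]
        omega
    · intro i _ hne
      apply if_neg
      rintro ⟨hl, a1, a2, -⟩
      rw [Finset.mem_range] at a1
      have := a2 a (by omega) (by rw [hl]; exact Γ.loopless.irrefl _)
      simp at this
    · intro h
      rw [Finset.mem_range] at h
      omega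

theorem word_lower {lab : ℕ → V} {N : ℕ} (hred : RedSeq Γ lab N) {e : ℕ → ℤ}
    (he : ∀ i, e i ≠ 0) (l : List (Raag Γ)) (hl : ∀ x ∈ l, IsSyllable Γ x)
    (hp : l.prod = PW Γ lab e 0 N) : N ≤ l.length := by
  by_contra hlt
  refine rep_PW Γ hred he N 0 (by omega) ?_
  rw [← hp]
  refine rep_vanish Γ hred _ N ?_ l hl _ ?_
  · intro S hS
    apply if_neg
    rintro rfl
    simp at hS
  · simp
    omega

end Rep

/-! ### Basic properties of the syllable length -/

section Len

variable {V : Type*} (Γ : SimpleGraph V)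

theorem IsSyllable_inv {s : Raag Γ} (h : IsSyllable Γ s) : IsSyllable Γ s⁻¹ := by
  obtain ⟨v, k, hk, rfl⟩ := h
  exact ⟨v, -k, by simpa using hk, by rw [zpow_neg]⟩

theorem syl_inv_word (g : Raag Γ) (l : List (Raag Γ)) (hl : ∀ x ∈ l, IsSyllable Γ x)
    (hp : l.prod = g) : ∃ l' : List (Raag Γ), l'.length = l.length ∧
      (∀ x ∈ l', IsSyllable Γ x) ∧ l'.prod = g⁻¹ := by
  refine ⟨(l.map (·⁻¹)).reverse, by simp, ?_, ?_⟩
  · intro x hx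
    rw [List.mem_reverse, List.mem_map] at hx
    obtain ⟨y, hy, rfl⟩ := hx
    exact IsSyllable_inv Γ (hl y hy)
  · rw [← hp, List.prod_inv_reverse]

theorem exists_word (g : Raag Γ) :
    ∃ l : List (Raag Γ), (∀ x ∈ l, IsSyllable Γ x) ∧ l.prod = g := by
  have hg : g ∈ Subgroup.closure (Set.range (PresentedGroup.of (rels := raagRels Γ))) := by
    rw [PresentedGroup.closure_range_of]
    trivial
  induction hg using Subgroup.closure_induction with
  | mem x hx =>
    obtain ⟨v, rfl⟩ := hx
    refine ⟨[raagGen Γ v], ?_, by simp [raagGen]⟩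
    intro x hx
    rw [List.mem_singleton] at hx
    exact ⟨v, 1, one_ne_zero, by rw [hx, zpow_one]⟩
  | one => exact ⟨[], by simp, rfl⟩
  | mul x y _ _ hx hy =>
    obtain ⟨l, h1, h2⟩ := hx
    obtain ⟨l', h1', h2'⟩ := hy
    refine ⟨l ++ l', ?_, by simp [h2, h2']⟩
    intro z hz
    rcases List.mem_append.1 hz with h | h
    · exact h1 z h
    · exact h1' z h
  | inv x _ hx =>
    obtain ⟨l, h1, h2⟩ := hx
    obtain ⟨l', -, h⟩ := syl_inv_word Γ x l h1 h2
    exact ⟨l', h⟩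

theorem syl_spec (g : Raag Γ) : ∃ l : List (Raag Γ), l.length = sylLength Γ g ∧
    (∀ x ∈ l, IsSyllable Γ x) ∧ l.prod = g := by
  have : sylLength Γ g ∈
      {n | ∃ l : List (Raag Γ), l.length = n ∧ (∀ x ∈ l, IsSyllable Γ x) ∧ l.prod = g} := by
    apply Nat.sInf_mem
    obtain ⟨l, h⟩ := exists_word Γ g
    exact ⟨_, l, rfl, h⟩
  exact this

theorem syl_le {g : Raag Γ} (l : List (Raag Γ)) (hl : ∀ x ∈ l, IsSyllable Γ x)
    (hp : l.prod = g) : sylLength Γ g ≤ l.length :=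
  Nat.sInf_le ⟨l, rfl, hl, hp⟩

theorem syl_mul_le (g h : Raag Γ) :
    sylLength Γ (g * h) ≤ sylLength Γ g + sylLength Γ h := by
  obtain ⟨l, h0, h1, h2⟩ := syl_spec Γ g
  obtain ⟨l', h0', h1', h2'⟩ := syl_spec Γ h
  rw [← h0, ← h0', ← List.length_append]
  refine syl_le Γ (l ++ l') ?_ (by simp [h2, h2'])
  intro z hz
  rcases List.mem_append.1 hz with h | h
  · exact h1 z h
  · exact h1' z h

theorem syl_one : sylLength Γ (1 : Raag Γ) = 0 :=
  Nat.le_zero.1 (syl_le Γ [] (by simp) rfl)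

theorem syl_zpow_le (v : V) (k : ℤ) : sylLength Γ (raagGen Γ v ^ k) ≤ 1 := by
  by_cases hk : k = 0
  · subst hk
    rw [zpow_zero, syl_one]
    exact zero_le_one
  · refine syl_le Γ [raagGen Γ v ^ k] ?_ (by simp)
    intro x hx
    rw [List.mem_singleton] at hx
    exact ⟨v, k, hk, hx⟩

theorem syl_inv_le (g : Raag Γ) : sylLength Γ g⁻¹ ≤ sylLength Γ g := by
  obtain ⟨l, h0, h1, h2⟩ := syl_spec Γ g
  obtain ⟨l', h0', h1', h2'⟩ := syl_inv_word Γ g l h1 h2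
  rw [← h0, ← h0']
  exact syl_le Γ l' h1' h2'

theorem syl_inv (g : Raag Γ) : sylLength Γ g⁻¹ = sylLength Γ g := by
  refine le_antisymm (syl_inv_le Γ g) ?_
  simpa using syl_inv_le Γ g⁻¹

theorem syl_PW_le {lab : ℕ → V} {e : ℕ → ℤ} (he : ∀ i, e i ≠ 0) (a b : ℕ) :
    sylLength Γ (PW Γ lab e a b) ≤ b := by
  obtain ⟨l, h0, h1, h2⟩ := PW_word Γ (lab := lab) he a b
  rw [← h0]
  exact syl_le Γ l h1 (by rw [h0, h2])

theorem gen_comm {u v : V} (h : Γ.Adj u v) : Commute (raagGen Γ u) (raagGen Γ v) := by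
  have : (PresentedGroup.mk (raagRels Γ)) (FreeGroup.of u * FreeGroup.of v * (FreeGroup.of u)⁻¹ *
      (FreeGroup.of v)⁻¹) = 1 :=
    PresentedGroup.one_of_mem ⟨u, v, h, rfl⟩
  simp only [map_mul, map_inv] at this
  change raagGen Γ u * raagGen Γ v * (raagGen Γ u)⁻¹ * (raagGen Γ v)⁻¹ = 1 at this
  have h2 := mul_inv_eq_one.1 this
  exact mul_inv_eq_iff_eq_mul.1 h2

theorem PW_commute {lab : ℕ → V} {e : ℕ → ℤ} (a b : ℕ) (v : V) (k : ℤ)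
    (h : ∀ i, i < b → Γ.Adj (lab (a + i)) v) :
    Commute (PW Γ lab e a b) (raagGen Γ v ^ k) := by
  refine Commute.list_prod_left _ _ fun x hx => ?_
  obtain ⟨i, hi, rfl⟩ := List.mem_map.1 hx
  exact (gen_comm Γ (h i (List.mem_range.1 hi))).zpow_zpow _ _

theorem PW_period {lab : ℕ → V} {e : ℕ → ℤ} {n : ℕ} (hlab : ∀ i, lab (n + i) = lab i)
    (hper : ∀ i, e (n + i) = e i) (a b : ℕ) : PW Γ lab e (n + a) b = PW Γ lab e a b := by
  simp only [PW, add_assoc, hlab, hper]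

theorem PW_pow {lab : ℕ → V} {e : ℕ → ℤ} {n : ℕ} (hlab : ∀ i, lab (n + i) = lab i)
    (hper : ∀ i, e (n + i) = e i) (m : ℕ) : PW Γ lab e 0 (m * n) = PW Γ lab e 0 n ^ m := by
  induction m with
  | zero => simp [PW_zero]
  | succ m ih =>
    rw [add_mul, one_mul, add_comm, PW_add, pow_succ', ← ih, zero_add]
    congr 1
    exact PW_period Γ hlab hper 0 _

theorem red_of_cyc {lab : ℕ → V} {e : ℕ → ℤ} {n : ℕ} (hlab : ∀ i, lab (n + i) = lab i)
    (hper : ∀ i, e (n + i) = e i) (he : ∀ i, e i ≠ 0) (hn : 0 < n)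
    (hcyc : ∀ h : Raag Γ, n ≤ sylLength Γ (h⁻¹ * PW Γ lab e 0 n * h))
    (hnotstar : ¬ IsStarElt Γ (PW Γ lab e 0 n)) (N : ℕ) : RedSeq Γ lab N := by
  intro i j hij _ hl
  by_contra hcon
  push Not at hcon
  by_cases hjn : j < i + n
  · -- the cyclic shift starting at position `i` can be shortened
    have hconj : (PW Γ lab e 0 i)⁻¹ * PW Γ lab e 0 n * PW Γ lab e 0 i = PW Γ lab e i n := by
      rw [mul_assoc, inv_mul_eq_iff_eq_mul]
      have h1 := PW_add Γ lab e 0 i n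
      have h2 := PW_add Γ lab e 0 n i
      rw [zero_add] at h1 h2
      have h3 := PW_period Γ hlab hper 0 i
      rw [add_zero] at h3
      rw [← h1, add_comm, h2, h3]
    have h0 := hcyc (PW Γ lab e 0 i)
    rw [hconj] at h0
    obtain ⟨p, rfl⟩ : ∃ p, j = i + 1 + p := ⟨j - (i + 1), by omega⟩
    obtain ⟨q, hq⟩ : ∃ q, n = 1 + (p + (1 + q)) := ⟨n - (p + 2), by omega⟩
    have hw : PW Γ lab e i n = raagGen Γ (lab i) ^ (e i + e (i + 1 + p)) *
        (PW Γ lab e (i + 1) p * PW Γ lab e (i + 1 + p + 1) q) := by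
      conv_lhs => rw [hq]
      rw [PW_add, PW_add, PW_add, PW_one, PW_one, ← hl, zpow_add]
      have := PW_commute Γ (lab := lab) (e := e) (i + 1) p (lab i) (e (i + 1 + p))
        (fun k hk => hcon _ (by omega) (by omega))
      rw [← mul_assoc (PW Γ lab e (i + 1) p), this.eq]
      simp only [mul_assoc]
    have b1 := syl_mul_le Γ (raagGen Γ (lab i) ^ (e i + e (i + 1 + p)))
        (PW Γ lab e (i + 1) p * PW Γ lab e (i + 1 + p + 1) q)
    have b2 := syl_mul_le Γ (PW Γ lab e (i + 1) p) (PW Γ lab e (i + 1 + p + 1) q)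
    have b3 := syl_zpow_le Γ (lab i) (e i + e (i + 1 + p))
    have b4 := syl_PW_le Γ (lab := lab) he (i + 1) p
    have b5 := syl_PW_le Γ (lab := lab) he (i + 1 + p + 1) q
    rw [hw] at h0
    omega
  · -- every label is in the star of `lab i`
    have hmul : ∀ c k, lab (k + c * n) = lab k := by
      intro c
      induction c with
      | zero => simp
      | succ c ih =>
        intro k
        rw [show k + (c + 1) * n = n + (k + c * n) by ring, hlab, ih]
    have hall : ∀ k, lab k ∈ starSet Γ (lab i) := by
      intro k
      -- choose a representative of `k` modulo `n` in `[i, i + n)`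
      have hbig : i ≤ k + i * n := by nlinarith
      have hr := Nat.mod_lt (k + i * n - i) hn
      have hd := Nat.mod_add_div (k + i * n - i) n
      have hk : lab k = lab (i + (k + i * n - i) % n) := by
        rw [← hmul i k, ← hmul ((k + i * n - i) / n) (i + (k + i * n - i) % n)]
        congr 1
        rw [mul_comm ((k + i * n - i) / n) n]
        omega
      rw [hk]
      rcases Nat.eq_zero_or_pos ((k + i * n - i) % n) with h | h
      · left
        rw [h, add_zero]
      · right
        exact hcon _ (by omega) (by omega)
    apply hnotstar
    refine ⟨lab i, Subgroup.list_prod_mem _ fun x hx => ?_⟩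
    obtain ⟨k, -, rfl⟩ := List.mem_map.1 hx
    exact Subgroup.zpow_mem _ (Subgroup.subset_closure (Set.mem_image_of_mem _ (hall _))) _

theorem exists_periodic {g : Raag Γ} (l : List (Raag Γ)) (hl : ∀ x ∈ l, IsSyllable Γ x)
    (hp : l.prod = g) (hn : 0 < l.length) : ∃ (lab : ℕ → V) (e : ℕ → ℤ),
      (∀ i, lab (l.length + i) = lab i) ∧ (∀ i, e (l.length + i) = e i) ∧ (∀ i, e i ≠ 0) ∧
      PW Γ lab e 0 l.length = g := by
  have hx : ∀ i : ℕ, ∃ p : V × ℤ, p.2 ≠ 0 ∧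
      l[i % l.length]'(Nat.mod_lt _ hn) = raagGen Γ p.1 ^ p.2 := by
    intro i
    obtain ⟨v, k, hk, h⟩ := hl _ (List.getElem_mem (Nat.mod_lt i hn))
    exact ⟨(v, k), hk, h⟩
  choose p hp1 hp2 using hx
  refine ⟨fun i => (p (i % l.length)).1, fun i => (p (i % l.length)).2, ?_, ?_, ?_, ?_⟩
  · intro i
    simp
  · intro i
    simp
  · intro i
    exact hp1 _
  · rw [← hp, PW]
    congr 1
    apply List.ext_getElem
    · simp
    · intro i h1 h2
      simp only [List.getElem_map, List.getElem_range, zero_add]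
      rw [← hp2]
      congr 1
      rw [Nat.mod_mod, Nat.mod_eq_of_lt h2]

theorem syl_pow (g : Raag Γ)
    (hcyc : ∀ h : Raag Γ, sylLength Γ g ≤ sylLength Γ (h⁻¹ * g * h))
    (hnotstar : ¬ IsStarElt Γ g) (m : ℕ) :
    sylLength Γ (g ^ m) = m * sylLength Γ g := by
  obtain ⟨l, h0, h1, h2⟩ := syl_spec Γ g
  rcases Nat.eq_zero_or_pos l.length with hz | hn
  · have hg : g = 1 := by
      rw [← h2, List.length_eq_zero_iff.1 hz]
      rfl
    rw [hg, one_pow, syl_one, mul_zero]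
  · obtain ⟨lab, e, c1, c2, c3, c4⟩ := exists_periodic Γ l h1 h2 hn
    rw [h0] at hn c1 c2 c4
    have hred := red_of_cyc Γ c1 c2 c3 hn (by rw [c4]; exact hcyc) (by rw [c4]; exact hnotstar)
      (m * sylLength Γ g)
    have hpow := PW_pow Γ c1 c2 m
    rw [c4] at hpow
    rw [← hpow]
    refine le_antisymm (syl_PW_le Γ c3 _ _) ?_
    obtain ⟨l', d0, d1, d2⟩ := syl_spec Γ (PW Γ lab e 0 (m * sylLength Γ g))
    rw [← d0]
    exact word_lower Γ hred c3 l' d1 d2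

end Len

/-- If `g` is cyclically syllable-reduced (its syllable length is minimal in its conjugacy class)
and is not a star word, then `‖g^m‖_syl = |m| · ‖g‖_syl` for every integer `m`. -/
theorem stmt10 {V : Type*} (Γ : SimpleGraph V) (g : Raag Γ)
    (hcyc : ∀ h : Raag Γ, sylLength Γ g ≤ sylLength Γ (h⁻¹ * g * h))
    (hnotstar : ¬ IsStarElt Γ g) (m : ℤ) :
    sylLength Γ (g ^ m) = m.natAbs * sylLength Γ g := by
  rcases Int.natAbs_eq m with h | h
  · conv_lhs => rw [h]
    rw [zpow_natCast]
    exact syl_pow Γ g hcyc hnotstar _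
  · conv_lhs => rw [h]
    rw [zpow_neg, zpow_natCast, syl_inv]
    exact syl_pow Γ g hcyc hnotstar _
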